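/- arXiv:1801.02968 — 2 statements merged into one kernel-verified Lean document; each statement's English description precedes it below -/
import Mathlib

section
/- Let s be a finite multiset of integers, each at least 3 and each strictly less than 132, with card s ≥ 3, and combinatorial curvature Φ(s) = 1 − (card s)/2 + Σ_{k ∈ s} 1/k. Then Φ(s) = 1/132 if and only if s ∈ { {3,3,4,11}, {4,6,11}, {3,11,12} }. In particular, every such pattern contains an element equal to 11. -/
/-- Combinatorial curvature of a vertex pattern `s` (multiset of face degrees). -/
def curvature (s : Multiset ℤ) : ℚ :=
  1 - (s.card : ℚ) / 2 + (s.map (fun k => (1 : ℚ) / (k : ℚ))).sum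

theorem mul_le_of_le_mul_one_div {p q : ℚ} {k : ℤ} (hk : 3 ≤ k) (h : p ≤ q * (1 / (k : ℚ))) :
    p * k ≤ q := by
  have hpos : (0 : ℚ) < k := by exact_mod_cast (by omega : 0 < k)
  rwa [mul_one_div, le_div_iff₀ hpos] at h

theorem one_div_intCast_le {a b : ℤ} (ha : 3 ≤ a) (hab : a ≤ b) :
    1 / (b : ℚ) ≤ 1 / (a : ℚ) := by
  have hpos : (0 : ℚ) < a := by exact_mod_cast (by omega : 0 < a)
  exact one_div_le_one_div_of_le hpos (by exact_mod_cast hab)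

theorem intCast_mul_eq_one {k : ℤ} {p : ℚ} (hk : 3 ≤ k) (h : 1 / (k : ℚ) = p) :
    p * k = 1 := by
  have hne : (k : ℚ) ≠ 0 := by exact_mod_cast (by omega : k ≠ 0)
  rw [← h, one_div_mul_cancel hne]

theorem sum_three_unit_fractions {a b c : ℤ} (ha : 3 ≤ a) (hab : a ≤ b) (hbc : b ≤ c)
    (hc : c < 132) (h : 1 / (a : ℚ) + 1 / (b : ℚ) + 1 / (c : ℚ) = 67 / 132) :
    (a = 4 ∧ b = 6 ∧ c = 11) ∨ (a = 3 ∧ b = 11 ∧ c = 12) := by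
  have hb : 3 ≤ b := ha.trans hab
  have hiab := one_div_intCast_le ha hab
  have hibc := one_div_intCast_le hb hbc
  have ha5 : a ≤ 5 := by
    have := mul_le_of_le_mul_one_div (p := 67 / 132) (q := 3) ha (by linarith)
    have : (a : ℚ) < 6 := by linarith
    have : a < 6 := by exact_mod_cast this
    omega
  have hb11 : b ≤ 11 := by
    have hia := one_div_intCast_le le_rfl ha
    push_cast at hia
    have := mul_le_of_le_mul_one_div (p := 23 / 132) (q := 2) hb (by linarith)
    have : (b : ℚ) < 12 := by linarith
    have : b < 12 := by exact_mod_cast this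
    omega
  have hmul := intCast_mul_eq_one (hb.trans hbc)
    (show 1 / (c : ℚ) = 67 / 132 - 1 / (a : ℚ) - 1 / (b : ℚ) by linarith)
  interval_cases a <;> interval_cases b <;> norm_num at hmul <;> field_simp at hmul <;>
    norm_cast at hmul <;> omega

theorem sum_four_unit_fractions {a b c d : ℤ} (ha : 3 ≤ a) (hab : a ≤ b) (hbc : b ≤ c)
    (hcd : c ≤ d) (hd : d < 132)
    (h : 1 / (a : ℚ) + 1 / (b : ℚ) + 1 / (c : ℚ) + 1 / (d : ℚ) = 133 / 132) :
    a = 3 ∧ b = 3 ∧ c = 4 ∧ d = 11 := by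
  have hb : 3 ≤ b := ha.trans hab
  have hc : 3 ≤ c := hb.trans hbc
  have hiab := one_div_intCast_le ha hab
  have hibc := one_div_intCast_le hb hbc
  have hicd := one_div_intCast_le hc hcd
  have ha3 : a = 3 := by
    have := mul_le_of_le_mul_one_div (p := 133 / 132) (q := 4) ha (by linarith)
    have : (a : ℚ) < 4 := by linarith
    have : a < 4 := by exact_mod_cast this
    omega
  subst ha3
  push_cast at h
  have hb4 : b ≤ 4 := by
    have := mul_le_of_le_mul_one_div (p := 89 / 132) (q := 3) hb (by linarith)
    have : (b : ℚ) < 5 := by linarith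
    have : b < 5 := by exact_mod_cast this
    omega
  have hc5 : c ≤ 5 := by
    have hib := one_div_intCast_le le_rfl hb
    push_cast at hib
    have := mul_le_of_le_mul_one_div (p := 45 / 132) (q := 2) hc (by linarith)
    have : (c : ℚ) < 6 := by linarith
    have : c < 6 := by exact_mod_cast this
    omega
  have hmul := intCast_mul_eq_one (hc.trans hcd)
    (show 1 / (d : ℚ) = 133 / 132 - 1 / 3 - 1 / (b : ℚ) - 1 / (c : ℚ) by linarith)
  interval_cases b <;> interval_cases c <;> norm_num at hmul <;> field_simp at hmul <;>
    norm_cast at hmul <;> omega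

theorem sum_five_unit_fractions_ne {a b c d e : ℤ} (ha : 3 ≤ a) (hab : a ≤ b) (hbc : b ≤ c)
    (hcd : c ≤ d) (hde : d ≤ e) :
    1 / (a : ℚ) + 1 / (b : ℚ) + 1 / (c : ℚ) + 1 / (d : ℚ) + 1 / (e : ℚ) ≠ 199 / 132 := by
  intro h
  have hia := one_div_intCast_le le_rfl ha
  have hib := one_div_intCast_le le_rfl (ha.trans hab)
  have hic := one_div_intCast_le le_rfl ((ha.trans hab).trans hbc)
  have hd : 3 ≤ d := ((ha.trans hab).trans hbc).trans hcd
  push_cast at hia hib hic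
  have hide := one_div_intCast_le hd hde
  have hd3 : d = 3 := by
    have := mul_le_of_le_mul_one_div (p := 67 / 132) (q := 2) hd (by linarith)
    have : (d : ℚ) < 4 := by linarith
    have : d < 4 := by exact_mod_cast this
    omega
  obtain ⟨rfl, rfl, rfl⟩ : a = 3 ∧ b = 3 ∧ c = 3 := by omega
  subst hd3
  have hmul := intCast_mul_eq_one (p := 23 / 132) (hd.trans hde) (by push_cast at h; linarith)
  field_simp at hmul
  norm_cast at hmul
  omega

theorem curvature_eq_sum_map (s : Multiset ℤ) :
    curvature s = 1 - (s.card : ℚ) / 2 + (s.map (fun k : ℤ => (1 : ℚ) / (k : ℚ))).sum := by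
  simp [curvature, Multiset.bind_def, Multiset.pure_def]

theorem card_le_five_of_curvature_pos {s : Multiset ℤ} (h3 : ∀ k ∈ s, 3 ≤ k)
    (hs : 0 < curvature s) : s.card ≤ 5 := by
  have hsum : (s.map (fun k : ℤ => (1 : ℚ) / (k : ℚ))).sum ≤ s.card • (1 / 3 : ℚ) := by
    rw [← Multiset.card_map (fun k : ℤ => (1 : ℚ) / (k : ℚ)) s]
    refine Multiset.sum_le_card_nsmul _ _ fun x hx => ?_
    obtain ⟨k, hk, rfl⟩ := Multiset.mem_map.1 hx
    simpa using one_div_intCast_le le_rfl (h3 k hk)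
  rw [nsmul_eq_mul] at hsum
  rw [curvature_eq_sum_map] at hs
  have : (s.card : ℚ) < 6 := by linarith
  have : s.card < 6 := by exact_mod_cast this
  omega

theorem patterns_of_curvature_eq {s : Multiset ℤ} (h3 : ∀ k ∈ s, (3 : ℤ) ≤ k ∧ k < 132)
    (hcard : 3 ≤ s.card) (hs : curvature s = 1 / 132) :
    s = {3, 3, 4, 11} ∨ s = {4, 6, 11} ∨ s = {3, 11, 12} := by
  have hcard5 := card_le_five_of_curvature_pos (fun k hk => (h3 k hk).1) (by rw [hs]; norm_num)
  obtain ⟨l, hl, rfl⟩ : ∃ l : List ℤ, l.Pairwise (· ≤ ·) ∧ (l : Multiset ℤ) = s :=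
    ⟨s.sort, s.pairwise_sort _, s.sort_eq _⟩
  match l with
  | [] | [_] | [_, _] => simp at hcard
  | [a, b, c] =>
    simp [curvature_eq_sum_map] at h3 hs hl
    rcases sum_three_unit_fractions (a := a) (b := b) (c := c) (by omega) (by omega) (by omega)
      (by omega) (by simp only [one_div]; linarith) with ⟨rfl, rfl, rfl⟩ | ⟨rfl, rfl, rfl⟩
    · exact Or.inr (Or.inl rfl)
    · exact Or.inr (Or.inr rfl)
  | [a, b, c, d] =>
    simp [curvature_eq_sum_map] at h3 hs hl
    obtain ⟨rfl, rfl, rfl, rfl⟩ := sum_four_unit_fractions (a := a) (b := b) (c := c) (d := d)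
      (by omega) (by omega) (by omega) (by omega) (by omega) (by simp only [one_div]; linarith)
    exact Or.inl rfl
  | [a, b, c, d, e] =>
    simp [curvature_eq_sum_map] at h3 hs hl
    exact absurd (by simp only [one_div]; linarith) (sum_five_unit_fractions_ne
      (a := a) (b := b) (c := c) (d := d) (e := e)
      (by omega) (by omega) (by omega) (by omega) (by omega))
  | _ :: _ :: _ :: _ :: _ :: _ :: _ => simp at hcard5; omega

theorem curvature_eq_one_div_132_patterns (s : Multiset ℤ)
    (h3 : ∀ k ∈ s, (3 : ℤ) ≤ k ∧ k < 132) (hcard : 3 ≤ Multiset.card s) :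
    (curvature s = 1 / 132 ↔
      (s = {3, 3, 4, 11} ∨ s = {4, 6, 11} ∨ s = {3, 11, 12})) ∧
      (curvature s = 1 / 132 → (11 : ℤ) ∈ s) := by
  refine ⟨⟨patterns_of_curvature_eq h3 hcard, ?_⟩, fun hs => ?_⟩
  · rintro (rfl | rfl | rfl) <;> norm_num [curvature_eq_sum_map]
  · rcases patterns_of_curvature_eq h3 hcard hs with rfl | rfl | rfl <;> simp
end

section
/- Let s be a finite multiset of integers, each at least 3, with card s ≥ 3 and combinatorial curvature Φ(s) = 1 − (card s)/2 + Σ_{k ∈ s} 1/k ≥ 0. If s contains both the element 3 and the element 8, then s is one of the following: {3,m,8} for some integer 3 ≤ m ≤ 24, or {3,3,3,8}, or {3,3,4,8}. -/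
theorem curvature_eq (s : Multiset ℤ) :
    curvature s = 1 - (s.card : ℚ) / 2 + (s.map fun k : ℤ => 1 / (k : ℚ)).sum := by
  simp [curvature, Multiset.bind_def, Multiset.pure_def, Multiset.bind_singleton,
    Multiset.map_map]

theorem curvature_cons (k : ℤ) (s : Multiset ℤ) :
    curvature (k ::ₘ s) = curvature s + (1 / (k : ℚ) - 1 / 2) := by
  simp only [curvature_eq, Multiset.card_cons, Multiset.map_cons, Multiset.sum_cons]
  push_cast
  ring

theorem curvature_zero : curvature 0 = 1 := by
  simp [curvature_eq]

theorem one_div_intCast_le_s11 {m k : ℤ} (hm : 0 < m) (hk : m ≤ k) :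
    1 / (k : ℚ) ≤ 1 / (m : ℚ) :=
  one_div_le_one_div_of_le (by exact_mod_cast hm) (by exact_mod_cast hk)

theorem curvature_le_of_forall_three_le {s : Multiset ℤ} (h : ∀ k ∈ s, (3 : ℤ) ≤ k) :
    curvature s ≤ 1 - (s.card : ℚ) / 6 := by
  induction s using Multiset.induction_on with
  | empty => simp [curvature_zero]
  | cons a s ih =>
    have hs := ih fun k hk => h k (Multiset.mem_cons_of_mem hk)
    have ha := one_div_intCast_le_s11 (by norm_num) (h a (Multiset.mem_cons_self a s))
    rw [curvature_cons, Multiset.card_cons]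
    push_cast at ha ⊢
    linarith

/-- Two face degrees `a ≤ b` which, next to a triangle and an octagon, leave the curvature
nonnegative. -/
theorem eq_three_and_le_four_of_le {a b : ℤ} (ha : 3 ≤ a) (hab : a ≤ b)
    (h : 13 / 24 ≤ 1 / (a : ℚ) + 1 / (b : ℚ)) : a = 3 ∧ b ≤ 4 := by
  have ha3 : a = 3 := by
    by_contra hne
    have h1 := one_div_intCast_le_s11 (m := 4) (by norm_num) (show 4 ≤ a by lia)
    have h2 := one_div_intCast_le_s11 (m := 4) (by norm_num) (show 4 ≤ b by lia)
    norm_num at h h1 h2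
    linarith
  refine ⟨ha3, ?_⟩
  by_contra hb
  have h1 := one_div_intCast_le_s11 (m := 5) (by norm_num) (show 5 ≤ b by lia)
  subst ha3
  norm_num at h h1
  linarith

theorem patterns_with_three_and_eight (s : Multiset ℤ)
    (h3 : ∀ k ∈ s, (3 : ℤ) ≤ k) (hcard : 3 ≤ Multiset.card s)
    (hΦ : 0 ≤ curvature s) (h3mem : (3 : ℤ) ∈ s) (h8mem : (8 : ℤ) ∈ s) :
    (∃ m : ℤ, 3 ≤ m ∧ m ≤ 24 ∧ s = {3, m, 8}) ∨
      s = {3, 3, 3, 8} ∨ s = {3, 3, 4, 8} := by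
  obtain ⟨u, rfl⟩ := Multiset.exists_cons_of_mem h3mem
  obtain ⟨t, rfl⟩ := Multiset.exists_cons_of_mem
    ((Multiset.mem_cons.mp h8mem).resolve_left (by norm_num))
  have ht : ∀ k ∈ t, (3 : ℤ) ≤ k := fun k hk => h3 k (by simp [hk])
  rw [curvature_cons, curvature_cons] at hΦ
  have hcard_lt : t.card < 3 := by
    by_contra! hge
    have hle := curvature_le_of_forall_three_le ht
    have hge' : (3 : ℚ) ≤ t.card := by exact_mod_cast hge
    push_cast at hΦ
    linarith
  simp only [Multiset.card_cons] at hcard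
  obtain hone | htwo : t.card = 1 ∨ t.card = 2 := by lia
  · obtain ⟨m, rfl⟩ := Multiset.card_eq_one.mp hone
    refine Or.inl ⟨m, ht m (by simp), ?_, ?_⟩
    · by_contra hm
      have hle := one_div_intCast_le_s11 (m := 25) (by norm_num) (show 25 ≤ m by lia)
      rw [← Multiset.cons_zero, curvature_cons, curvature_zero] at hΦ
      push_cast at hΦ hle
      linarith
    · exact congrArg (3 ::ₘ ·) (Multiset.pair_comm 8 m)
  · obtain ⟨a, b, rfl⟩ := Multiset.card_eq_two.mp htwo
    right
    wlog hab : a ≤ b generalizing a b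
    · rw [Multiset.pair_comm a b] at *
      exact this b a ‹_› ‹_› ‹_› ‹_› ‹_› ‹_› ‹_› ‹_› (by lia)
    have ha := ht a (by simp)
    rw [Multiset.insert_eq_cons, ← Multiset.cons_zero, curvature_cons, curvature_cons,
      curvature_zero] at hΦ
    obtain ⟨rfl, hb⟩ := eq_three_and_le_four_of_le ha hab (by push_cast at hΦ; linarith)
    obtain rfl | rfl : b = 3 ∨ b = 4 := by lia
    · left; decide
    · right; decide
end
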